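/- Let X ∈ ℝ^{n×d}, B* ∈ ℝ^{d×q}, W ∈ ℝ^{n×q}, and Y = X B* + W. Suppose B̂ minimizes F(B) = (1/2)‖Y − X B‖_F² + λ‖B‖_{2,1} over ℝ^{d×q}, and suppose the regularization parameter satisfies λ ≥ 2‖Xᵀ W‖_{2,∞}. Then, writing Δ = B̂ − B*, one has ‖X Δ‖_F² ≤ 3λ‖Δ‖_{2,1}. -/

import Mathlib

open Matrix BigOperators

/-- The Frobenius norm of a real matrix: `‖A‖_F = sqrt (Σ_{i,j} A_{ij}²)`. -/
noncomputable def frobNorm {m n : ℕ} (A : Matrix (Fin m) (Fin n) ℝ) : ℝ :=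
  Real.sqrt (∑ i, ∑ j, (A i j) ^ 2)

/-- The Euclidean norm of the `i`-th row of a real matrix. -/
noncomputable def rowNorm {m n : ℕ} (A : Matrix (Fin m) (Fin n) ℝ) (i : Fin m) : ℝ :=
  Real.sqrt (∑ j, (A i j) ^ 2)

/-- The `ℓ_{2,1}`-norm of a real matrix: the sum of the Euclidean norms of its rows. -/
noncomputable def l21Norm {m n : ℕ} (A : Matrix (Fin m) (Fin n) ℝ) : ℝ :=
  ∑ i, rowNorm A i

/-- The `ℓ_{2,∞}`-norm of a real matrix: the maximal Euclidean norm of a row. -/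
noncomputable def l2infNorm {m n : ℕ} (A : Matrix (Fin m) (Fin n) ℝ) : ℝ :=
  ⨆ i, rowNorm A i

theorem frobNorm_sq {m n : ℕ} (A : Matrix (Fin m) (Fin n) ℝ) :
    frobNorm A ^ 2 = ∑ i, ∑ j, (A i j) ^ 2 :=
  Real.sq_sqrt (Finset.sum_nonneg fun _ _ => Finset.sum_nonneg fun _ _ => sq_nonneg _)

theorem frobNorm_sub_sq {m n : ℕ} (A B : Matrix (Fin m) (Fin n) ℝ) :
    frobNorm (A - B) ^ 2 =
      frobNorm A ^ 2 - 2 * ∑ i, ∑ j, A i j * B i j + frobNorm B ^ 2 := by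
  simp only [frobNorm_sq, Finset.mul_sum, ← Finset.sum_sub_distrib, ← Finset.sum_add_distrib,
    Matrix.sub_apply]
  refine Finset.sum_congr rfl fun i _ => Finset.sum_congr rfl fun j _ => ?_
  ring

theorem rowNorm_nonneg {m n : ℕ} (A : Matrix (Fin m) (Fin n) ℝ) (i : Fin m) :
    0 ≤ rowNorm A i :=
  Real.sqrt_nonneg _

theorem l21Norm_nonneg {m n : ℕ} (A : Matrix (Fin m) (Fin n) ℝ) : 0 ≤ l21Norm A :=
  Finset.sum_nonneg fun i _ => rowNorm_nonneg A i

theorem rowNorm_eq_norm {m n : ℕ} (A : Matrix (Fin m) (Fin n) ℝ) (i : Fin m) :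
    rowNorm A i = ‖WithLp.toLp 2 (A i)‖ := by
  simp [rowNorm, EuclideanSpace.norm_eq]

theorem l21Norm_le_add_l21Norm_sub {m n : ℕ} (A B : Matrix (Fin m) (Fin n) ℝ) :
    l21Norm B ≤ l21Norm A + l21Norm (A - B) := by
  simp only [l21Norm, ← Finset.sum_add_distrib]
  refine Finset.sum_le_sum fun i _ => ?_
  simp only [rowNorm_eq_norm]
  exact norm_le_insert (WithLp.toLp 2 (A i)) (WithLp.toLp 2 (B i))

theorem rowNorm_le_l2infNorm {m n : ℕ} (A : Matrix (Fin m) (Fin n) ℝ) (i : Fin m) :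
    rowNorm A i ≤ l2infNorm A :=
  le_ciSup (Set.finite_range (rowNorm A)).bddAbove i

theorem l2infNorm_nonneg {m n : ℕ} (A : Matrix (Fin m) (Fin n) ℝ) : 0 ≤ l2infNorm A :=
  Real.iSup_nonneg (rowNorm_nonneg A)

theorem sum_mul_le_l2infNorm_mul_l21Norm {m n : ℕ} (A B : Matrix (Fin m) (Fin n) ℝ) :
    ∑ i, ∑ j, A i j * B i j ≤ l2infNorm A * l21Norm B := by
  rw [l21Norm, Finset.mul_sum]
  refine Finset.sum_le_sum fun i _ => ?_
  exact (Real.sum_mul_le_sqrt_mul_sqrt _ _ _).trans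
    (mul_le_mul_of_nonneg_right (rowNorm_le_l2infNorm A i) (rowNorm_nonneg B i))

theorem sum_mul_mul_eq_sum_transpose_mul_mul {n d q : ℕ} (X : Matrix (Fin n) (Fin d) ℝ)
    (W : Matrix (Fin n) (Fin q) ℝ) (D : Matrix (Fin d) (Fin q) ℝ) :
    ∑ i, ∑ j, W i j * (X * D) i j = ∑ k, ∑ j, (Xᵀ * W) k j * D k j := by
  have inner_eq_trace {m n : ℕ} (A B : Matrix (Fin m) (Fin n) ℝ) :
      ∑ i, ∑ j, A i j * B i j = (Aᵀ * B).trace := by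
    simp only [Matrix.trace, Matrix.diag_apply, Matrix.mul_apply, Matrix.transpose_apply]
    exact Finset.sum_comm
  rw [inner_eq_trace, inner_eq_trace, Matrix.transpose_mul, Matrix.transpose_transpose,
    Matrix.mul_assoc]

/-- **Deterministic prediction-error bound for the group lasso.** If `Y = X B* + W`,
`B̂` minimizes `B ↦ (1/2)‖Y − X B‖_F² + λ‖B‖_{2,1}`, and `λ ≥ 2‖Xᵀ W‖_{2,∞}`, then with
`Δ = B̂ − B*`, `‖X Δ‖_F² ≤ 3λ‖Δ‖_{2,1}`. -/
theorem group_lasso_prediction_bound {n d q : ℕ}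
    (X : Matrix (Fin n) (Fin d) ℝ) (Bstar : Matrix (Fin d) (Fin q) ℝ)
    (W : Matrix (Fin n) (Fin q) ℝ) (lam : ℝ)
    (Y : Matrix (Fin n) (Fin q) ℝ) (hY : Y = X * Bstar + W)
    (Bhat : Matrix (Fin d) (Fin q) ℝ)
    (hmin : ∀ B : Matrix (Fin d) (Fin q) ℝ,
      (1 / 2) * frobNorm (Y - X * Bhat) ^ 2 + lam * l21Norm Bhat ≤
      (1 / 2) * frobNorm (Y - X * B) ^ 2 + lam * l21Norm B)
    (hlam : 2 * l2infNorm (Xᵀ * W) ≤ lam) :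
    frobNorm (X * (Bhat - Bstar)) ^ 2 ≤ 3 * lam * l21Norm (Bhat - Bstar) := by
  have hres : Y - X * Bhat = W - X * (Bhat - Bstar) := by
    rw [hY, Matrix.mul_sub]; abel
  have hres' : Y - X * Bstar = W := by rw [hY]; abel
  have hbasic := hmin Bstar
  rw [hres, hres', frobNorm_sub_sq, sum_mul_mul_eq_sum_transpose_mul_mul] at hbasic
  have hlam0 : 0 ≤ lam := by linarith [l2infNorm_nonneg (Xᵀ * W)]
  have hnoise := sum_mul_le_l2infNorm_mul_l21Norm (Xᵀ * W) (Bhat - Bstar)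
  have hdual := mul_le_mul_of_nonneg_right hlam
    (l21Norm_nonneg (Bhat - Bstar))
  have htri := mul_le_mul_of_nonneg_left (l21Norm_le_add_l21Norm_sub Bhat Bstar) hlam0
  linarith
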